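/- Among the four two-point sampling schemes on [0,1]² — (i) plain Monte Carlo (two independent uniform points in [0,1]²), (ii) jittered sampling with Ω the triangle {y ≤ x} below the main diagonal, (iii) jittered sampling with Ω = [0,1]×[0,1/2], and (iv) jittered sampling with Ω the triangle {x + y ≤ 1} below the anti-diagonal — the expected squared L2-discrepancies are strictly decreasing in this order: 5/72 > 23/360 > 1/18 > 1/20. -/

import Mathlib

open MeasureTheory Set

noncomputable section

/-- The closed unit square `[0,1]²` in `ℝ × ℝ`. -/
def unitSq : Set (ℝ × ℝ) := Icc (0:ℝ) 1 ×ˢ Icc (0:ℝ) 1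

/-- The anchored axis-parallel box `[0,x] × [0,y]`. -/
def box (x y : ℝ) : Set (ℝ × ℝ) := Icc (0:ℝ) x ×ˢ Icc (0:ℝ) y

/-- The uniform probability measure on a set `S ⊆ ℝ²`. -/
def unif (S : Set (ℝ × ℝ)) : Measure (ℝ × ℝ) := (volume S)⁻¹ • volume.restrict S

/-- The number of the two points `p1`, `p2` lying in the box `[0,x] × [0,y]`. -/
def countIn (p1 p2 : ℝ × ℝ) (x y : ℝ) : ℝ :=
  (box x y).indicator (fun _ => (1:ℝ)) p1 + (box x y).indicator (fun _ => (1:ℝ)) p2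

/-- The squared L2 discrepancy of the two-point multiset `{p1, p2}`. -/
def L2sq (p1 p2 : ℝ × ℝ) : ℝ :=
  ∫ x in (0:ℝ)..1, ∫ y in (0:ℝ)..1, |countIn p1 p2 x y / 2 - x * y| ^ 2

/-- The joint law of the jittered pair `(p1, p2)`: `p1` uniform on `Ω`,
`p2` uniform on `[0,1]² \ Ω`, independent. -/
def jitter (Ω : Set (ℝ × ℝ)) : Measure ((ℝ × ℝ) × (ℝ × ℝ)) :=
  (unif Ω).prod (unif (unitSq \ Ω))

/-- The expected squared L2 discrepancy of the two-point jittered sampling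
construction associated to `Ω`. -/
def Djit (Ω : Set (ℝ × ℝ)) : ℝ := ∫ q, L2sq q.1 q.2 ∂(jitter Ω)

/-- `f1 Ω x y` is the Lebesgue measure of `Ω ∩ ([0,x] × [0,y])`. -/
def f1 (Ω : Set (ℝ × ℝ)) (x y : ℝ) : ℝ := (volume (Ω ∩ box x y)).toReal

/-- The hypograph of `g` within the unit square. -/
def hypo (g : ℝ → ℝ) : Set (ℝ × ℝ) := {q ∈ unitSq | q.2 ≤ g q.1}

/-- `g` is an admissible partitioning function for area `p`: it is monotonically
decreasing on `[0,1]`, maps `[0,1]` into `[0,1]`, its hypograph has Lebesgue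
measure `p`, and its hypograph is symmetric about the diagonal `y = x` up to a
Lebesgue-null set. -/
def Admissible (p : ℝ) (g : ℝ → ℝ) : Prop :=
  AntitoneOn g (Icc (0:ℝ) 1) ∧ (∀ x ∈ Icc (0:ℝ) 1, g x ∈ Icc (0:ℝ) 1) ∧
  volume (hypo g) = ENNReal.ofReal p ∧
  (∀ᵐ q ∂(volume.restrict unitSq), (q ∈ hypo g ↔ q.swap ∈ hypo g))

end

/-- The indicator of membership in an anchored box is measurable jointly in the point and the
corner of the box. -/
lemma measurable_box_indicator :
    Measurable fun z : (ℝ × ℝ) × (ℝ × ℝ) => (box z.2.1 z.2.2).indicator (fun _ => (1:ℝ)) z.1 := by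
  have hS : MeasurableSet {z : (ℝ × ℝ) × (ℝ × ℝ) | z.1 ∈ box z.2.1 z.2.2} := by
    have h {f g : (ℝ × ℝ) × (ℝ × ℝ) → ℝ} (hf : Measurable f) (hg : Measurable g) :
        MeasurableSet {z | f z ≤ g z} := measurableSet_le hf hg
    exact ((h measurable_const measurable_fst.fst).inter
        (h measurable_fst.fst measurable_snd.fst)).inter
      ((h measurable_const measurable_fst.snd).inter (h measurable_fst.snd measurable_snd.snd))
  exact (measurable_const (a := (1:ℝ))).indicator hS

lemma measurableSet_box (x y : ℝ) : MeasurableSet (box x y) :=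
  measurableSet_Icc.prod measurableSet_Icc

lemma indicator_one_mem_Icc {α : Type*} (s : Set α) (a : α) :
    s.indicator (fun _ => (1:ℝ)) a ∈ Icc (0:ℝ) 1 := by
  by_cases h : a ∈ s <;> simp [h]

/-- The squared local discrepancy of two points is measurable jointly in the points and the
corner of the box. -/
lemma measurable_sq_local_discrepancy :
    Measurable fun w : ((ℝ × ℝ) × (ℝ × ℝ)) × (ℝ × ℝ) =>
      |countIn w.1.1 w.1.2 w.2.1 w.2.2 / 2 - w.2.1 * w.2.2| ^ 2 := by
  have h1 := measurable_box_indicator.comp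
    (f := fun w : ((ℝ × ℝ) × (ℝ × ℝ)) × (ℝ × ℝ) => (w.1.1, w.2)) (by fun_prop)
  have h2 := measurable_box_indicator.comp
    (f := fun w : ((ℝ × ℝ) × (ℝ × ℝ)) × (ℝ × ℝ) => (w.1.2, w.2)) (by fun_prop)
  have h3 := (h1.add h2).div_const 2
  have h4 : Measurable fun w : ((ℝ × ℝ) × (ℝ × ℝ)) × (ℝ × ℝ) => w.2.1 * w.2.2 := by fun_prop
  simp only [sq_abs]
  exact (h3.sub h4).pow_const 2

lemma sq_local_discrepancy_le_one (p q : ℝ × ℝ) {x y : ℝ} (hx : x ∈ Ioc (0:ℝ) 1)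
    (hy : y ∈ Ioc (0:ℝ) 1) : |countIn p q x y / 2 - x * y| ^ 2 ≤ 1 := by
  have h1 := indicator_one_mem_Icc (box x y) p
  have h2 := indicator_one_mem_Icc (box x y) q
  have h3 : x * y ≤ 1 := mul_le_one₀ hx.2 hy.1.le hy.2
  have h4 : 0 < x * y := mul_pos hx.1 hy.1
  have h5 : |countIn p q x y / 2 - x * y| ≤ 1 := by
    rw [abs_le, countIn]
    constructor <;> linarith [h1.1, h1.2, h2.1, h2.2]
  exact pow_le_one₀ (abs_nonneg _) h5

/-- The mean squared local discrepancy of two independent points in terms of the probabilities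
that they lie in the box. -/
lemma integral_sq_local_discrepancy (μ ν : Measure (ℝ × ℝ)) [IsProbabilityMeasure μ]
    [IsProbabilityMeasure ν] (x y : ℝ) :
    ∫ q, |countIn q.1 q.2 x y / 2 - x * y| ^ 2 ∂(μ.prod ν) =
      (μ.real (box x y) + ν.real (box x y) + 2 * (μ.real (box x y) * ν.real (box x y))) / 4
        - (μ.real (box x y) + ν.real (box x y)) * (x * y) + (x * y) ^ 2 := by
  set I : ℝ × ℝ → ℝ := (box x y).indicator fun _ => (1:ℝ) with hI
  have hm := measurableSet_box x y
  have hsq (p : ℝ × ℝ) : I p ^ 2 = I p := by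
    by_cases h : p ∈ box x y <;> simp [hI, h]
  have hiμ : Integrable I μ := (integrable_const (1:ℝ)).indicator hm
  have hiν : Integrable I ν := (integrable_const (1:ℝ)).indicator hm
  have h1 : Integrable (fun q : (ℝ × ℝ) × (ℝ × ℝ) => I q.1) (μ.prod ν) := hiμ.comp_fst ν
  have h2 : Integrable (fun q : (ℝ × ℝ) × (ℝ × ℝ) => I q.2) (μ.prod ν) := hiν.comp_snd μ
  have h3 : Integrable (fun q : (ℝ × ℝ) × (ℝ × ℝ) => I q.1 * I q.2) (μ.prod ν) := hiμ.mul_prod hiν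
  have e (q : (ℝ × ℝ) × (ℝ × ℝ)) : |countIn q.1 q.2 x y / 2 - x * y| ^ 2 =
      (1 / 4 - x * y) * I q.1 + (1 / 4 - x * y) * I q.2 + (1 / 2) * (I q.1 * I q.2)
        + (x * y) ^ 2 := by
    rw [sq_abs]
    change ((I q.1 + I q.2) / 2 - x * y) ^ 2 = _
    linear_combination (1 / 4) * hsq q.1 + (1 / 4) * hsq q.2
  simp_rw [e]
  have h4 : Integrable (fun q : (ℝ × ℝ) × (ℝ × ℝ) =>
      (1 / 4 - x * y) * I q.1 + (1 / 4 - x * y) * I q.2) (μ.prod ν) :=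
    (h1.const_mul _).add (h2.const_mul _)
  have h5 : Integrable (fun q : (ℝ × ℝ) × (ℝ × ℝ) =>
      (1 / 4 - x * y) * I q.1 + (1 / 4 - x * y) * I q.2 + (1 / 2) * (I q.1 * I q.2)) (μ.prod ν) :=
    h4.add (h3.const_mul _)
  rw [integral_add h5 (integrable_const _), integral_add h4 (h3.const_mul _),
    integral_add (h1.const_mul _) (h2.const_mul _), integral_const_mul, integral_const_mul,
    integral_const_mul, integral_prod_mul, integral_fun_fst, integral_fun_snd, integral_const]
  have iμ : ∫ p, I p ∂μ = μ.real (box x y) := integral_indicator_one hm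
  have iν : ∫ p, I p ∂ν = ν.real (box x y) := integral_indicator_one hm
  simp only [iμ, iν, probReal_univ, smul_eq_mul]
  ring

/-- The expected squared discrepancy of two independent points, as an integral over the box
corner. -/
lemma integral_L2sq (μ ν : Measure (ℝ × ℝ)) [IsProbabilityMeasure μ] [IsProbabilityMeasure ν] :
    ∫ q, L2sq q.1 q.2 ∂(μ.prod ν) = ∫ x in (0:ℝ)..1, ∫ y in (0:ℝ)..1,
      ((μ.real (box x y) + ν.real (box x y) + 2 * (μ.real (box x y) * ν.real (box x y))) / 4
        - (μ.real (box x y) + ν.real (box x y)) * (x * y) + (x * y) ^ 2) := by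
  simp_rw [← integral_sq_local_discrepancy μ ν, L2sq,
    intervalIntegral.integral_of_le (zero_le_one (α := ℝ))]
  set ρ : Measure ℝ := volume.restrict (Ioc (0:ℝ) 1) with hρ
  have hF : Integrable (fun w : ((ℝ × ℝ) × (ℝ × ℝ)) × (ℝ × ℝ) =>
      |countIn w.1.1 w.1.2 w.2.1 w.2.2 / 2 - w.2.1 * w.2.2| ^ 2)
      ((μ.prod ν).prod (ρ.prod ρ)) := by
    refine Integrable.of_bound measurable_sq_local_discrepancy.aestronglyMeasurable 1 ?_
    have h0 : ∀ᵐ z ∂(ρ.prod ρ), z ∈ Ioc (0:ℝ) 1 ×ˢ Ioc (0:ℝ) 1 := by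
      rw [hρ, Measure.prod_restrict]
      exact ae_restrict_mem (measurableSet_Ioc.prod measurableSet_Ioc)
    filter_upwards [Measure.quasiMeasurePreserving_snd.ae h0] with w hw
    rw [Real.norm_of_nonneg (by positivity)]
    exact sq_local_discrepancy_le_one _ _ hw.1 hw.2
  calc _ = ∫ q, ∫ z, |countIn q.1 q.2 z.1 z.2 / 2 - z.1 * z.2| ^ 2 ∂(ρ.prod ρ) ∂(μ.prod ν) := by
        refine integral_congr_ae ?_
        filter_upwards [hF.prod_right_ae] with q hq
        exact (integral_prod _ hq).symm
    _ = ∫ z, ∫ q, |countIn q.1 q.2 z.1 z.2 / 2 - z.1 * z.2| ^ 2 ∂(μ.prod ν) ∂(ρ.prod ρ) :=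
        integral_integral_swap hF
    _ = _ := integral_prod _ hF.integral_prod_right

lemma unitSq_eq_box : unitSq = box 1 1 := rfl

lemma volume_real_box {x y : ℝ} (hx : 0 ≤ x) (hy : 0 ≤ y) : volume.real (box x y) = x * y := by
  rw [box, Measure.volume_eq_prod, measureReal_prod_prod]
  simp [hx, hy]

lemma volume_box_ne_top (x y : ℝ) : volume (box x y) ≠ ⊤ :=
  (isCompact_Icc.prod isCompact_Icc).measure_ne_top

lemma box_subset_unitSq {x y : ℝ} (hx : x ≤ 1) (hy : y ≤ 1) : box x y ⊆ unitSq :=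
  prod_mono (Icc_subset_Icc_right hx) (Icc_subset_Icc_right hy)

lemma unif_real_apply (S : Set (ℝ × ℝ)) {T : Set (ℝ × ℝ)} (hT : MeasurableSet T) :
    (unif S).real T = (volume.real S)⁻¹ * volume.real (S ∩ T) := by
  rw [unif, measureReal_ennreal_smul_apply, measureReal_restrict_apply hT, inter_comm,
    ENNReal.toReal_inv]
  rfl

lemma isProbabilityMeasure_unif {S : Set (ℝ × ℝ)} (h : volume.real S ≠ 0) :
    IsProbabilityMeasure (unif S) := by
  have h' := ENNReal.toReal_ne_zero.1 h
  constructor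
  rw [unif, Measure.smul_apply, Measure.restrict_apply_univ, smul_eq_mul]
  exact ENNReal.inv_mul_cancel h'.1 h'.2

lemma integral_unitInterval_congr₂ {f g : ℝ → ℝ → ℝ}
    (h : ∀ x ∈ Icc (0:ℝ) 1, ∀ y ∈ Icc (0:ℝ) 1, f x y = g x y) :
    ∫ x in (0:ℝ)..1, ∫ y in (0:ℝ)..1, f x y = ∫ x in (0:ℝ)..1, ∫ y in (0:ℝ)..1, g x y := by
  rw [← uIcc_of_le (zero_le_one (α := ℝ))] at h
  exact intervalIntegral.integral_congr fun x hx =>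
    intervalIntegral.integral_congr fun y hy => h x hx y hy

/-- The expected squared discrepancy of jittered sampling from a set of area one half. -/
lemma Djit_eq {Ω : Set (ℝ × ℝ)} (hΩ : MeasurableSet Ω) (hsub : Ω ⊆ unitSq)
    (hvol : f1 Ω 1 1 = 1 / 2) :
    Djit Ω = ∫ x in (0:ℝ)..1, ∫ y in (0:ℝ)..1,
      (x * y / 2 - (x * y) ^ 2 + 2 * (x * y) * f1 Ω x y - 2 * f1 Ω x y ^ 2) := by
  have hcompl {x y : ℝ} (hx : x ∈ Icc (0:ℝ) 1) (hy : y ∈ Icc (0:ℝ) 1) :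
      volume.real ((unitSq \ Ω) ∩ box x y) = x * y - f1 Ω x y := by
    have h := measureReal_inter_add_sdiff (μ := volume) (s := box x y) hΩ (volume_box_ne_top x y)
    have e : (unitSq \ Ω) ∩ box x y = box x y \ Ω := by
      ext q
      have := @box_subset_unitSq x y hx.2 hy.2 q
      simp only [mem_inter_iff, mem_sdiff]
      tauto
    rw [volume_real_box hx.1 hy.1, inter_comm] at h
    rw [e, ← h, f1, Measure.real, Measure.real]
    ring
  have one_mem : (1:ℝ) ∈ Icc (0:ℝ) 1 := by simp
  have hv : volume.real Ω = 1 / 2 := by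
    rw [← hvol, f1, ← unitSq_eq_box, inter_eq_left.2 hsub, Measure.real]
  have hv' : volume.real (unitSq \ Ω) = 1 / 2 := by
    have := hcompl one_mem one_mem
    rw [← unitSq_eq_box, inter_eq_left.2 sdiff_subset, hvol] at this
    linarith
  have := isProbabilityMeasure_unif (S := Ω) (by rw [hv]; norm_num)
  have := isProbabilityMeasure_unif (S := unitSq \ Ω) (by rw [hv']; norm_num)
  rw [Djit, jitter, integral_L2sq]
  refine integral_unitInterval_congr₂ fun x hx y hy => ?_
  rw [unif_real_apply _ (measurableSet_box x y), unif_real_apply _ (measurableSet_box x y), hv, hv',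
    hcompl hx hy, show volume.real (Ω ∩ box x y) = f1 Ω x y from rfl]
  ring

lemma measurableSet_hypo {g : ℝ → ℝ} (hg : Measurable g) : MeasurableSet (hypo g) :=
  (measurableSet_box 1 1).inter (measurableSet_le measurable_snd (hg.comp measurable_fst))

lemma f1_hypo {g : ℝ → ℝ} (hg : Continuous g) (h0 : ∀ u ∈ Icc (0:ℝ) 1, 0 ≤ g u) {x y : ℝ}
    (hx : x ∈ Icc (0:ℝ) 1) (hy : y ∈ Icc (0:ℝ) 1) :
    f1 (hypo g) x y = ∫ u in (0:ℝ)..x, min y (g u) := by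
  have hsec (u : ℝ) : volume (Prod.mk u ⁻¹' (hypo g ∩ box x y)) =
      (Icc 0 x).indicator (fun u => ENNReal.ofReal (min y (g u))) u := by
    by_cases hu : u ∈ Icc 0 x
    · have : Prod.mk u ⁻¹' (hypo g ∩ box x y) = Icc 0 (min y (g u)) := by
        ext v
        simp only [hypo, unitSq, box, mem_preimage, mem_inter_iff, mem_ofPred_eq, mem_prod, mem_Icc,
          le_min_iff] at *
        constructor
        · tauto
        · intro h
          exact ⟨⟨⟨⟨hu.1, hu.2.trans hx.2⟩, h.1, h.2.1.trans hy.2⟩, h.2.2⟩, hu, h.1, h.2.1⟩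
      rw [this, indicator_of_mem hu, Real.volume_Icc, sub_zero]
    · have : Prod.mk u ⁻¹' (hypo g ∩ box x y) = ∅ :=
        eq_empty_of_forall_notMem fun v hv => hu hv.2.1
      rw [this, indicator_of_notMem hu, measure_empty]
  rw [f1, Measure.volume_eq_prod,
    Measure.prod_apply ((measurableSet_hypo hg.measurable).inter (measurableSet_box x y))]
  simp_rw [hsec]
  rw [lintegral_indicator measurableSet_Icc, intervalIntegral.integral_of_le hx.1,
    ← integral_Icc_eq_integral_Ioc, integral_eq_lintegral_of_nonneg_ae]
  · refine (ae_restrict_iff' measurableSet_Icc).2 (Filter.Eventually.of_forall fun u hu => ?_)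
    exact le_min hy.1 (h0 u ⟨hu.1, hu.2.trans hx.2⟩)
  · exact (continuous_const.min hg).aestronglyMeasurable

lemma integral_poly (c₀ c₁ c₂ c₃ c₄ c₅ a b : ℝ) :
    ∫ t in a..b, (c₀ + c₁ * t + c₂ * t ^ 2 + c₃ * t ^ 3 + c₄ * t ^ 4 + c₅ * t ^ 5) =
      c₀ * (b - a) + c₁ * (b ^ 2 - a ^ 2) / 2 + c₂ * (b ^ 3 - a ^ 3) / 3
        + c₃ * (b ^ 4 - a ^ 4) / 4 + c₄ * (b ^ 5 - a ^ 5) / 5 + c₅ * (b ^ 6 - a ^ 6) / 6 := by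
  have hF (t : ℝ) : HasDerivAt (fun t : ℝ => c₀ * t + c₁ / 2 * t ^ 2 + c₂ / 3 * t ^ 3
      + c₃ / 4 * t ^ 4 + c₄ / 5 * t ^ 5 + c₅ / 6 * t ^ 6)
      (c₀ + c₁ * t + c₂ * t ^ 2 + c₃ * t ^ 3 + c₄ * t ^ 4 + c₅ * t ^ 5) t := by
    have h := ((((((hasDerivAt_id' t).const_mul c₀).add ((hasDerivAt_pow 2 t).const_mul (c₁ / 2))).add
      ((hasDerivAt_pow 3 t).const_mul (c₂ / 3))).add ((hasDerivAt_pow 4 t).const_mul (c₃ / 4))).add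
      ((hasDerivAt_pow 5 t).const_mul (c₄ / 5))).add ((hasDerivAt_pow 6 t).const_mul (c₅ / 6))
    refine h.congr_deriv ?_
    push_cast
    ring
  rw [intervalIntegral.integral_eq_sub_of_hasDerivAt (fun t _ => hF t)
    (Continuous.intervalIntegrable (by fun_prop) a b)]
  ring

lemma integral_of_eqOn_poly {f : ℝ → ℝ} {a b : ℝ} (hab : a ≤ b) (c₀ c₁ c₂ c₃ c₄ c₅ : ℝ)
    (h : ∀ t ∈ Icc a b, f t = c₀ + c₁ * t + c₂ * t ^ 2 + c₃ * t ^ 3 + c₄ * t ^ 4 + c₅ * t ^ 5) :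
    ∫ t in a..b, f t = c₀ * (b - a) + c₁ * (b ^ 2 - a ^ 2) / 2 + c₂ * (b ^ 3 - a ^ 3) / 3
        + c₃ * (b ^ 4 - a ^ 4) / 4 + c₄ * (b ^ 5 - a ^ 5) / 5 + c₅ * (b ^ 6 - a ^ 6) / 6 := by
  rw [← integral_poly]
  rw [← uIcc_of_le hab] at h
  exact intervalIntegral.integral_congr h

/-- An interval integral computed by splitting at an intermediate point. -/
lemma integral_split {f : ℝ → ℝ} {a b c : ℝ} (hf : Continuous f) :
    ∫ t in a..c, f t = (∫ t in a..b, f t) + ∫ t in b..c, f t :=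
  (intervalIntegral.integral_add_adjacent_intervals (hf.intervalIntegrable a b)
    (hf.intervalIntegrable b c)).symm

/-- The expected squared discrepancy of jittered sampling from the hypograph of `g`, once the
measures of its intersections with boxes are known. -/
lemma Djit_hypo_eq {g : ℝ → ℝ} (hg : Continuous g) {A : ℝ → ℝ → ℝ}
    (hA : ∀ x ∈ Icc (0:ℝ) 1, ∀ y ∈ Icc (0:ℝ) 1, f1 (hypo g) x y = A x y) (h1 : A 1 1 = 1 / 2) :
    Djit (hypo g) = ∫ x in (0:ℝ)..1, ∫ y in (0:ℝ)..1,
      (x * y / 2 - (x * y) ^ 2 + 2 * (x * y) * A x y - 2 * A x y ^ 2) := by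
  rw [Djit_eq (measurableSet_hypo hg.measurable) (fun q hq => hq.1)
    ((hA 1 (by simp) 1 (by simp)).trans h1)]
  exact integral_unitInterval_congr₂ fun x hx y hy => by rw [hA x hx y hy]

lemma monteCarlo_eq : ∫ q, L2sq q.1 q.2 ∂((unif unitSq).prod (unif unitSq)) = 5 / 72 := by
  have hv : volume.real unitSq = 1 := by
    rw [unitSq_eq_box, volume_real_box zero_le_one zero_le_one, mul_one]
  have := isProbabilityMeasure_unif (S := unitSq) (by rw [hv]; norm_num)
  have e : ∀ x ∈ Icc (0:ℝ) 1, ∀ y ∈ Icc (0:ℝ) 1, (unif unitSq).real (box x y) = x * y := by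
    intro x hx y hy
    rw [unif_real_apply _ (measurableSet_box x y), hv,
      inter_eq_right.2 (box_subset_unitSq hx.2 hy.2), volume_real_box hx.1 hy.1, inv_one, one_mul]
  rw [integral_L2sq, integral_of_eqOn_poly zero_le_one 0 (1 / 4) (-1 / 6) 0 0 0]
  · norm_num
  · intro x hx
    rw [integral_of_eqOn_poly zero_le_one 0 (x / 2) (-x ^ 2 / 2) 0 0 0]
    · ring
    · intro y hy
      rw [e x hx y hy]
      ring

lemma f1_hypo_id {x y : ℝ} (hx : x ∈ Icc (0:ℝ) 1) (hy : y ∈ Icc (0:ℝ) 1) :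
    f1 (hypo fun u => u) x y = x * min x y - min x y ^ 2 / 2 := by
  rw [f1_hypo continuous_id' (fun u hu => hu.1) hx hy]
  rcases le_total x y with h | h
  · rw [min_eq_left h, integral_of_eqOn_poly hx.1 0 1 0 0 0 0]
    · ring
    · intro u hu
      rw [min_eq_right (hu.2.trans h)]
      ring
  · rw [min_eq_right h, integral_split (b := y) (by fun_prop),
      integral_of_eqOn_poly hy.1 0 1 0 0 0 0, integral_of_eqOn_poly h y 0 0 0 0 0]
    · ring
    · intro u hu
      rw [min_eq_left hu.1]
      ring
    · intro u hu
      rw [min_eq_right hu.2]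
      ring

lemma Djit_hypo_id : Djit (hypo fun u => u) = 23 / 360 := by
  rw [Djit_hypo_eq continuous_id' (fun x hx y hy => f1_hypo_id hx hy) (by norm_num),
    integral_of_eqOn_poly zero_le_one 0 (1 / 4) (-1 / 3) (1 / 2) (-1 / 2) (3 / 20)]
  · norm_num
  · intro x hx
    rw [integral_split (b := x) (by fun_prop),
      integral_of_eqOn_poly hx.1 0 (x / 2) (-x ^ 2) x (-1 / 2) 0,
      integral_of_eqOn_poly hx.2 (-x ^ 4 / 2) (x / 2 + x ^ 3) (-x ^ 2) 0 0 0]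
    · ring
    · intro y hy
      rw [min_eq_left hy.1]
      ring
    · intro y hy
      rw [min_eq_right hy.2]
      ring

lemma f1_hypo_half {x y : ℝ} (hx : x ∈ Icc (0:ℝ) 1) (hy : y ∈ Icc (0:ℝ) 1) :
    f1 (hypo fun _ => 1 / 2) x y = x * min y (1 / 2) := by
  rw [f1_hypo continuous_const (fun u hu => by norm_num) hx hy]
  simp

lemma Djit_hypo_half : Djit (hypo fun _ => 1 / 2) = 1 / 18 := by
  rw [Djit_hypo_eq continuous_const (fun x hx y hy => f1_hypo_half hx hy) (by norm_num),
    integral_of_eqOn_poly zero_le_one 0 (1 / 4) (-5 / 24) 0 0 0]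
  · norm_num
  · intro x hx
    rw [integral_split (b := 1 / 2) (by fun_prop),
      integral_of_eqOn_poly (by norm_num) 0 (x / 2) (-x ^ 2) 0 0 0,
      integral_of_eqOn_poly (by norm_num) (-x ^ 2 / 2) (x / 2 + x ^ 2) (-x ^ 2) 0 0 0]
    · ring
    · intro y hy
      rw [min_eq_right hy.1]
      ring
    · intro y hy
      rw [min_eq_left hy.2]
      ring

lemma f1_hypo_one_sub {x y : ℝ} (hx : x ∈ Icc (0:ℝ) 1) (hy : y ∈ Icc (0:ℝ) 1) :
    f1 (hypo fun u => 1 - u) x y = x * y - max (x + y - 1) 0 ^ 2 / 2 := by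
  rw [f1_hypo (by fun_prop) (fun u hu => sub_nonneg.2 hu.2) hx hy]
  rcases le_total (x + y - 1) 0 with h | h
  · rw [max_eq_right h, integral_of_eqOn_poly hx.1 y 0 0 0 0 0]
    · ring
    · intro u hu
      rw [min_eq_left (by linarith [hu.2])]
      ring
  · rw [max_eq_left h, integral_split (b := 1 - y) (by fun_prop),
      integral_of_eqOn_poly (sub_nonneg.2 hy.2) y 0 0 0 0 0,
      integral_of_eqOn_poly (by linarith) 1 (-1) 0 0 0 0]
    · ring
    · intro u hu
      rw [min_eq_right (by linarith [hu.1])]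
      ring
    · intro u hu
      rw [min_eq_left (by linarith [hu.2])]
      ring

lemma Djit_hypo_one_sub : Djit (hypo fun u => 1 - u) = 1 / 20 := by
  rw [Djit_hypo_eq (by fun_prop) (fun x hx y hy => f1_hypo_one_sub hx hy) (by norm_num),
    integral_of_eqOn_poly zero_le_one 0 (1 / 4) (-1 / 3) 0 (1 / 3) (-11 / 60)]
  · norm_num
  · intro x hx
    rw [integral_split (b := 1 - x) (by fun_prop),
      integral_of_eqOn_poly (sub_nonneg.2 hx.2) 0 (x / 2) (-x ^ 2) 0 0 0,
      integral_of_eqOn_poly (by linarith [hx.1]) (-(x - 1) ^ 4 / 2)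
        (x / 2 + x * (x - 1) ^ 2 - 2 * (x - 1) ^ 3) (-x ^ 2 + 2 * x * (x - 1) - 3 * (x - 1) ^ 2)
        (x - 2 * (x - 1)) (-1 / 2) 0]
    · ring
    · intro y hy
      rw [max_eq_left (by linarith [hy.1])]
      ring
    · intro y hy
      rw [max_eq_right (by linarith [hy.2])]
      ring

/-- The expected squared L2-discrepancies of the four two-point
schemes — plain Monte Carlo, jittered sampling with the triangle below the main
diagonal, with the lower half square, and with the triangle below the
anti-diagonal — equal `5/72`, `23/360`, `1/18`, `1/20` respectively, and are
strictly decreasing in this order. -/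
theorem four_schemes_strictly_decreasing :
    (∫ q, L2sq q.1 q.2 ∂((unif unitSq).prod (unif unitSq))) = 5/72 ∧
    Djit {q ∈ unitSq | q.2 ≤ q.1} = 23/360 ∧
    Djit (Icc (0:ℝ) 1 ×ˢ Icc (0:ℝ) (1/2)) = 1/18 ∧
    Djit {q ∈ unitSq | q.1 + q.2 ≤ 1} = 1/20 ∧
    (∫ q, L2sq q.1 q.2 ∂((unif unitSq).prod (unif unitSq)))
      > Djit {q ∈ unitSq | q.2 ≤ q.1} ∧
    Djit {q ∈ unitSq | q.2 ≤ q.1} > Djit (Icc (0:ℝ) 1 ×ˢ Icc (0:ℝ) (1/2)) ∧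
    Djit (Icc (0:ℝ) 1 ×ˢ Icc (0:ℝ) (1/2)) > Djit {q ∈ unitSq | q.1 + q.2 ≤ 1} := by
  have half : Icc (0:ℝ) 1 ×ˢ Icc (0:ℝ) (1/2) = hypo fun _ => 1 / 2 := by
    ext q
    simp only [hypo, unitSq, mem_prod, mem_Icc, mem_ofPred_eq]
    constructor
    · rintro ⟨h1, h2, h3⟩
      exact ⟨⟨h1, h2, by linarith⟩, h3⟩
    · rintro ⟨⟨h1, h2, _⟩, h3⟩
      exact ⟨h1, h2, h3⟩
  have anti : {q ∈ unitSq | q.1 + q.2 ≤ 1} = hypo fun u => 1 - u := by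
    ext q
    simp only [hypo, mem_ofPred_eq, le_sub_iff_add_le']
  have diag : {q ∈ unitSq | q.2 ≤ q.1} = hypo fun u => u := rfl
  rw [half, anti, diag, monteCarlo_eq, Djit_hypo_id, Djit_hypo_half, Djit_hypo_one_sub]
  norm_num
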